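/- Let G be a connected bipartite simple graph on n vertices. Then max{ n·MD_ε(G), E(G) } ≤ LE_ε(G) ≤ n·MD_ε(G) + E(G), where ε is the eccentricity vertex weight. -/

import Mathlib

open Matrix Finset

set_option linter.unusedSectionVars false

variable {V : Type*} [Fintype V] [DecidableEq V]

/-- The adjacency matrix of a simple graph over `ℝ` is Hermitian. -/
lemma adjMatrix_isHermitian (G : SimpleGraph V) [DecidableRel G.Adj] :
    (G.adjMatrix ℝ).IsHermitian :=
  Matrix.IsHermitian.ext fun i j => by
    simp [Matrix.IsHermitian, SimpleGraph.adjMatrix_apply, SimpleGraph.adj_comm]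

/-- The weighted Laplacian matrix `D_ω(G) - A(G)` of a simple graph with
vertex weight `w`. -/
noncomputable def wLaplacian (G : SimpleGraph V) [DecidableRel G.Adj] (w : V → ℝ) :
    Matrix V V ℝ :=
  Matrix.diagonal w - G.adjMatrix ℝ

lemma wLaplacian_isHermitian (G : SimpleGraph V) [DecidableRel G.Adj] (w : V → ℝ) :
    (wLaplacian G w).IsHermitian :=
  (Matrix.isHermitian_diagonal w).sub (adjMatrix_isHermitian G)

/-- The energy of a graph: the sum of the absolute values of the eigenvalues of
its adjacency matrix, `E(G) = Σ_i |λ_i|`. -/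
noncomputable def graphEnergy (G : SimpleGraph V) [DecidableRel G.Adj] : ℝ :=
  ∑ i, |(adjMatrix_isHermitian G).eigenvalues i|

/-- The average `ω̄ = (Σ_v ω(v))/n` of a vertex weight. -/
noncomputable def avgWeight (w : V → ℝ) : ℝ :=
  (∑ v, w v) / (Fintype.card V : ℝ)

/-- The Laplacian energy of `G` with respect to the vertex weight `w`:
`LE_ω(G) = Σ_i |μ_i − ω̄|` where the `μ_i` are the eigenvalues of
`D_ω(G) - A(G)`. -/
noncomputable def wLapEnergy (G : SimpleGraph V) [DecidableRel G.Adj] (w : V → ℝ) : ℝ :=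
  ∑ i, |(wLaplacian_isHermitian G w).eigenvalues i - avgWeight w|

/-- The mean deviation of a vertex weight: `MD_ω(G) = (1/n) Σ_v |ω(v) − ω̄|`. -/
noncomputable def meanDev (w : V → ℝ) : ℝ :=
  (∑ v, |w v - avgWeight w|) / (Fintype.card V : ℝ)

/-- The eccentricity of a vertex: `ε(u) = max_v d_G(u,v)`. -/
noncomputable def ecc (G : SimpleGraph V) (u : V) : ℝ :=
  ((Finset.univ.sup fun v => G.dist u v : ℕ) : ℝ)


def HasTN (M : Matrix V V ℝ) (r : ℝ) : Prop :=
  ∃ U ∈ Matrix.unitaryGroup V ℝ, ∃ d : V → ℝ, M = U * diagonal d * star U ∧ r = ∑ i, |d i|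

lemma HasTN.trace_le {M : Matrix V V ℝ} {r : ℝ} (h : HasTN M r) {Q : Matrix V V ℝ}
    (hQ : Q ∈ Matrix.unitaryGroup V ℝ) : (M * Q).trace ≤ r := by
  obtain ⟨U, hU, d, rfl, rfl⟩ := h
  have h1 : (U * diagonal d * star U * Q).trace = (diagonal d * (star U * Q * U)).trace := by
    rw [Matrix.mul_assoc, Matrix.mul_assoc, Matrix.trace_mul_comm]
    simp only [Matrix.mul_assoc]
  have hW : star U * Q * U ∈ Matrix.unitaryGroup V ℝ :=
    mul_mem (mul_mem (Unitary.star_mem hU) hQ) hU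
  rw [h1, Matrix.trace]
  refine Finset.sum_le_sum fun i _ => ?_
  rw [Matrix.diag_apply, Matrix.diagonal_mul]
  have h2 := entry_norm_bound_of_unitary hW i i
  rw [Real.norm_eq_abs] at h2
  calc _ ≤ |d i * (star U * Q * U) i i| := le_abs_self _
    _ = |d i| * |(star U * Q * U) i i| := abs_mul _ _
    _ ≤ |d i| := mul_le_of_le_one_right (abs_nonneg _) h2

lemma diag_mem_unitary (s : V → ℝ) (hs : ∀ i, s i * s i = 1) :
    diagonal s ∈ Matrix.unitaryGroup V ℝ := by
  rw [Matrix.mem_unitaryGroup_iff, Matrix.star_eq_conjTranspose, Matrix.diagonal_conjTranspose,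
    Matrix.diagonal_mul_diagonal]
  simp [hs]

lemma HasTN.exists_eq {M : Matrix V V ℝ} {r : ℝ} (h : HasTN M r) :
    ∃ Q ∈ Matrix.unitaryGroup V ℝ, (M * Q).trace = r := by
  obtain ⟨U, hU, d, rfl, rfl⟩ := h
  let s : V → ℝ := fun i => if 0 ≤ d i then 1 else -1
  have hs : diagonal s ∈ Matrix.unitaryGroup V ℝ :=
    diag_mem_unitary s fun i => by simp only [s]; split_ifs <;> norm_num
  refine ⟨U * diagonal s * star U, mul_mem (mul_mem hU hs) (Unitary.star_mem hU), ?_⟩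
  have hUU : star U * U = 1 := Matrix.mem_unitaryGroup_iff'.1 hU
  have h1 : U * diagonal d * star U * (U * diagonal s * star U)
      = U * (diagonal d * diagonal s * star U) := by
    calc _ = U * diagonal d * (star U * U) * diagonal s * star U := by
          simp only [Matrix.mul_assoc]
      _ = _ := by rw [hUU]; simp only [Matrix.mul_assoc, Matrix.one_mul]
  rw [h1, Matrix.trace_mul_comm, Matrix.mul_assoc, hUU, Matrix.mul_one,
    Matrix.diagonal_mul_diagonal, Matrix.trace_diagonal]
  refine Finset.sum_congr rfl fun i _ => ?_
  simp only [s]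
  split_ifs with h0
  · rw [abs_of_nonneg h0, mul_one]
  · rw [abs_of_neg (not_le.1 h0)]; ring

lemma HasTN.smul_le {M X Y : Matrix V V ℝ} {r x y k : ℝ} (h : HasTN M r) (hX : HasTN X x)
    (hY : HasTN Y y) (he : k • M = X + Y) : k * r ≤ x + y := by
  obtain ⟨Q, hQ, rfl⟩ := h.exists_eq
  have := congrArg (fun Z => (Z * Q).trace) he
  simp only [Matrix.smul_mul, Matrix.trace_smul, Matrix.add_mul, Matrix.trace_add,
    smul_eq_mul] at this
  rw [this]
  exact add_le_add (hX.trace_le hQ) (hY.trace_le hQ)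

lemma HasTN.neg {M : Matrix V V ℝ} {r : ℝ} (h : HasTN M r) : HasTN (-M) r := by
  obtain ⟨U, hU, d, rfl, rfl⟩ := h
  refine ⟨U, hU, fun i => -d i, ?_, by simp⟩
  rw [← Matrix.diagonal_neg, Matrix.mul_neg, Matrix.neg_mul]

lemma HasTN.conj {M S : Matrix V V ℝ} {r : ℝ} (h : HasTN M r)
    (hS : S ∈ Matrix.unitaryGroup V ℝ) : HasTN (S * M * star S) r := by
  obtain ⟨U, hU, d, rfl, rfl⟩ := h
  exact ⟨S * U, mul_mem hS hU, d, by simp only [star_mul, Matrix.mul_assoc], rfl⟩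

lemma hasTN_herm {M : Matrix V V ℝ} (hM : M.IsHermitian) (c : ℝ) :
    HasTN (M - diagonal fun _ => c) (∑ i, |hM.eigenvalues i - c|) := by
  refine ⟨hM.eigenvectorUnitary, hM.eigenvectorUnitary.2, fun i => hM.eigenvalues i - c, ?_, rfl⟩
  have h := hM.spectral_theorem
  rw [Unitary.conjStarAlgAut_apply] at h
  have hU : (hM.eigenvectorUnitary : Matrix V V ℝ) * star (hM.eigenvectorUnitary : Matrix V V ℝ)
    = 1 := Matrix.mem_unitaryGroup_iff.1 hM.eigenvectorUnitary.2
  have hc : (diagonal fun _ : V => c) = c • (1 : Matrix V V ℝ) := by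
    ext i j; simp [Matrix.diagonal_apply, Matrix.one_apply]
  rw [← Matrix.diagonal_sub, hc, Matrix.mul_sub, Matrix.sub_mul, Matrix.mul_smul,
    Matrix.smul_mul, Matrix.mul_one, hU]
  congr 1

theorem wLapEnergy_ecc_bounds (G : SimpleGraph V) [DecidableRel G.Adj]
    (hG : G.Connected) (hb : G.Colorable 2) :
    max ((Fintype.card V : ℝ) * meanDev (ecc G)) (graphEnergy G) ≤ wLapEnergy G (ecc G) ∧
    wLapEnergy G (ecc G) ≤ (Fintype.card V : ℝ) * meanDev (ecc G) + graphEnergy G := by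
  generalize ecc G = w
  obtain ⟨col⟩ := hb
  have : Nonempty V := hG.nonempty
  have hn : (Fintype.card V : ℝ) ≠ 0 := by exact_mod_cast Fintype.card_ne_zero
  have hmd : (Fintype.card V : ℝ) * meanDev w = ∑ v, |w v - avgWeight w| := by
    rw [meanDev, mul_div_cancel₀ _ hn]
  rw [hmd]
  let D : Matrix V V ℝ := diagonal fun v => w v - avgWeight w
  have hD : HasTN D (∑ v, |w v - avgWeight w|) :=
    ⟨1, one_mem _, fun v => w v - avgWeight w, by simp [D], rfl⟩
  have hA : HasTN (G.adjMatrix ℝ) (graphEnergy G) := by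
    have := hasTN_herm (adjMatrix_isHermitian G) 0
    simpa [graphEnergy] using this
  have hB : HasTN (D - G.adjMatrix ℝ) (wLapEnergy G w) := by
    have := hasTN_herm (wLaplacian_isHermitian G w) (avgWeight w)
    have e : wLaplacian G w - (diagonal fun _ => avgWeight w) = D - G.adjMatrix ℝ := by
      simp only [D, wLaplacian, ← Matrix.diagonal_sub]
      abel
    rw [e] at this
    exact this
  let s : V → ℝ := fun v => if col v = 0 then 1 else -1
  have hss : ∀ i, s i * s i = 1 := fun i => by simp only [s]; split_ifs <;> norm_num
  have hC : HasTN (D + G.adjMatrix ℝ) (wLapEnergy G w) := by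
    have := hB.conj (diag_mem_unitary s hss)
    convert this using 1
    rw [Matrix.star_eq_conjTranspose, Matrix.diagonal_conjTranspose]
    ext i j
    rw [Matrix.mul_diagonal, Matrix.diagonal_mul]
    simp only [D, Matrix.add_apply, Matrix.sub_apply, Matrix.diagonal_apply,
      SimpleGraph.adjMatrix_apply, star_trivial]
    by_cases hij : i = j
    · subst hij
      simp only [if_true, SimpleGraph.irrefl, if_false]
      linear_combination (-(w i - avgWeight w)) * hss i
    · by_cases hadj : G.Adj i j
      · have hv := col.valid hadj
        have hs : s i * s j = -1 := by
          simp only [s]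
          split_ifs with h1 h2 h2
          · exact absurd (h1.trans h2.symm) hv
          · norm_num
          · norm_num
          · exfalso; omega
        simp only [hij, hadj, if_true, if_false]
        linear_combination hs
      · simp [hij, hadj]
  refine ⟨max_le ?_ ?_, ?_⟩
  · have := hD.smul_le (k := 2) hB hC (by rw [two_smul]; abel)
    linarith
  · have := hA.smul_le (k := 2) hC hB.neg (by rw [two_smul]; abel)
    linarith
  · have := hB.smul_le (k := 1) hD hA.neg (by rw [one_smul]; abel)
    linarith
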